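/- No homeomorphism of the closed unit interval [0,1] has the two-sided limit shadowing property, and no homeomorphism of the unit circle has the two-sided limit shadowing property. -/

import Mathlib

open Filter Topology

/-- A two-sided limit pseudo-orbit: `d(f(x i), x (i+1)) → 0` as `|i| → ∞`. -/
def IsTwoSidedLimitPseudoOrbit {Y : Type*} [MetricSpace Y] (f : Y ≃ Y) (x : ℤ → Y) : Prop :=
  Tendsto (fun i : ℤ => dist (f (x i)) (x (i + 1))) cofinite (𝓝 0)

/-- `f` has the two-sided limit shadowing property. -/
def TwoSidedLimitShadowing {Y : Type*} [MetricSpace Y] (f : Y ≃ Y) : Prop :=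
  ∀ x : ℤ → Y, IsTwoSidedLimitPseudoOrbit f x →
    ∃ y : Y, Tendsto (fun i : ℤ => dist ((f ^ i) y) (x i)) cofinite (𝓝 0)

theorem TwoSidedLimitShadowing.pow {Y : Type*} [MetricSpace Y] {f : Equiv.Perm Y}
    (hf : TwoSidedLimitShadowing f) {k : ℕ} (hk : 0 < k) :
    TwoSidedLimitShadowing (f ^ k : Equiv.Perm Y) := by
  intro x hx
  have hk' : (0 : ℤ) < k := by exact_mod_cast hk
  have hdiv : Tendsto (fun i : ℤ => i / (k : ℤ)) cofinite cofinite := by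
    refine Tendsto.cofinite_of_finite_preimage_singleton fun m => ?_
    refine (Set.finite_Icc (k * m) (k * m + k)).subset fun i hi => ?_
    have hi' : i / (k : ℤ) = m := hi
    have h1 := Int.mul_ediv_add_emod i k
    have h2 := Int.emod_nonneg i hk'.ne'
    have h3 := Int.emod_lt_of_pos i hk'
    rw [hi'] at h1
    constructor <;> linarith
  obtain ⟨y, hy⟩ := hf (fun i => (f ^ (i % (k : ℤ))) (x (i / (k : ℤ)))) (by
    refine squeeze_zero (fun _ => dist_nonneg) (fun i => ?_) (hx.comp hdiv)
    have h1 := Int.mul_ediv_add_emod i k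
    have h2 := Int.emod_nonneg i hk'.ne'
    have h3 := Int.emod_lt_of_pos i hk'
    have hs : f ((f ^ (i % (k : ℤ))) (x (i / (k : ℤ)))) =
        (f ^ (i % (k : ℤ) + 1)) (x (i / (k : ℤ))) := by
      rw [add_comm, zpow_add, zpow_one, Equiv.Perm.mul_apply]
    simp only [Function.comp_apply]
    rw [hs]
    rcases eq_or_ne (i % (k : ℤ) + 1) k with h | h
    · have hi : i + 1 = (k : ℤ) * (i / k + 1) := by linarith
      have hq : (i + 1) / (k : ℤ) = i / k + 1 := by
        rw [hi]; exact Int.mul_ediv_cancel_left _ hk'.ne'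
      have hr : (i + 1) % (k : ℤ) = 0 := by rw [hi]; exact Int.mul_emod_right _ _
      rw [h, hq, hr, zpow_zero, zpow_natCast]
      rfl
    · have hlt : i % (k : ℤ) + 1 < k := by omega
      have hi : i + 1 = (i % k + 1) + (k : ℤ) * (i / k) := by linarith
      have hq : (i + 1) / (k : ℤ) = i / k := by
        rw [hi, Int.add_mul_ediv_left _ _ hk'.ne',
          Int.ediv_eq_zero_of_lt (by omega) hlt, zero_add]
      have hr : (i + 1) % (k : ℤ) = i % k + 1 := by
        rw [hi, Int.add_mul_emod_self_left, Int.emod_eq_of_lt (by omega) hlt]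
      rw [hq, hr, dist_self]
      exact dist_nonneg)
  refine ⟨y, ?_⟩
  have hinj : Tendsto (fun i : ℤ => (k : ℤ) * i) cofinite cofinite :=
    (mul_right_injective₀ hk'.ne').tendsto_cofinite
  refine (hy.comp hinj).congr fun i => ?_
  simp only [Function.comp_apply, Int.mul_emod_right, zpow_zero, zpow_mul, zpow_natCast,
    Int.mul_ediv_cancel_left _ hk'.ne']
  rfl

theorem TwoSidedLimitShadowing.exists_tendsto_fixedPoints {Y : Type*} [MetricSpace Y]
    {f : Equiv.Perm Y} (hf : TwoSidedLimitShadowing f) {p q : Y} (hp : f p = p) (hq : f q = q) :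
    ∃ y, Tendsto (fun n : ℕ => (f ^ (n : ℤ)) y) atTop (𝓝 q) ∧
      Tendsto (fun n : ℕ => (f ^ (-(n : ℤ))) y) atTop (𝓝 p) := by
  obtain ⟨y, hy⟩ := hf (fun i => if i < 0 then p else q) (by
    refine (tendsto_const_nhds (x := (0 : ℝ))).congr' ?_
    rw [EventuallyEq, eventually_cofinite]
    refine (Set.finite_singleton (-1)).subset fun i hi => ?_
    by_contra hne
    apply hi
    have hne' : i ≠ -1 := hne
    rcases lt_or_ge i 0 with h | h
    · have : i + 1 < 0 := by omega
      simp only [if_pos h, if_pos this]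
      exact ((congrArg (dist · p) hp).trans (dist_self p)).symm
    · have h' : ¬ i < 0 := by omega
      have : ¬ i + 1 < 0 := by omega
      simp only [if_neg h', if_neg this]
      exact ((congrArg (dist · q) hq).trans (dist_self q)).symm)
  rw [Int.cofinite_eq, tendsto_sup] at hy
  refine ⟨y, ?_, ?_⟩
  · rw [tendsto_iff_dist_tendsto_zero]
    refine (hy.2.comp tendsto_natCast_atTop_atTop).congr fun n => ?_
    simp only [Function.comp_apply, if_neg (Int.natCast_nonneg n).not_gt]
  · rw [tendsto_iff_dist_tendsto_zero]
    refine (hy.1.comp (tendsto_neg_atTop_atBot.comp tendsto_natCast_atTop_atTop)).congr' ?_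
    filter_upwards [eventually_gt_atTop 0] with n hn
    have : -(n : ℤ) < 0 := by omega
    simp only [Function.comp_apply, if_pos this]

theorem Continuous.tendsto_dist_comp {ι A B : Type*} [PseudoMetricSpace A] [PseudoMetricSpace B]
    [CompactSpace A] {g : A → B} (hg : Continuous g) {l : Filter ι} {a b : ι → A}
    (hab : Tendsto (fun i => dist (a i) (b i)) l (𝓝 0)) :
    Tendsto (fun i => dist (g (a i)) (g (b i))) l (𝓝 0) := by
  have huv : Tendsto (fun i => (a i, b i)) l (uniformity A) :=
    tendsto_uniformity_iff_dist_tendsto_zero.2 hab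
  exact tendsto_uniformity_iff_dist_tendsto_zero.1
    (Tendsto.comp (CompactSpace.uniformContinuous_of_continuous hg) huv)

theorem TwoSidedLimitShadowing.symm_conj {Y Z : Type*} [MetricSpace Y] [MetricSpace Z]
    [CompactSpace Y] [CompactSpace Z] {f : Equiv.Perm Y} (hf : TwoSidedLimitShadowing f)
    (h : Z ≃ₜ Y) : TwoSidedLimitShadowing (h.toEquiv.symm.permCongr f) := by
  intro x hx
  obtain ⟨y, hy⟩ := hf (fun i => h (x i)) (by
    refine (h.continuous.tendsto_dist_comp hx).congr fun i => ?_
    simp [Equiv.permCongr_apply])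
  refine ⟨h.symm y, (h.symm.continuous.tendsto_dist_comp hy).congr fun i => ?_⟩
  have : (h.toEquiv.symm.permCongr f ^ i : Equiv.Perm Z) = h.toEquiv.symm.permCongr (f ^ i) :=
    (map_zpow h.toEquiv.symm.permCongrHom f i).symm
  rw [this]
  simp [Equiv.permCongr_apply]

theorem not_twoSidedLimitShadowing_unitInterval (f : Set.Icc (0 : ℝ) 1 ≃ₜ Set.Icc (0 : ℝ) 1) :
    ¬ TwoSidedLimitShadowing f.toEquiv := by
  intro hf
  have hg := TwoSidedLimitShadowing.pow (f := f.toEquiv) hf two_pos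
  set g : Equiv.Perm (Set.Icc (0 : ℝ) 1) := f.toEquiv ^ 2 with hgdef
  have hgf : ∀ x, g x = f (f x) := fun x => rfl
  have hmono : StrictMono g := by
    rcases Continuous.strictMono_of_inj_boundedOrder' f.continuous f.injective with h | h
    · exact h.comp h
    · exact h.comp h
  have hpow : ∀ n : ℕ, StrictMono (g ^ n) := fun n => by
    rw [Equiv.Perm.coe_pow]; exact hmono.iterate n
  have h0 : g ⊥ = ⊥ := by
    refine le_bot_iff.1 ?_
    calc g ⊥ ≤ g (g.symm ⊥) := hmono.monotone bot_le
      _ = ⊥ := g.apply_symm_apply _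
  have h1 : g ⊤ = ⊤ := by
    refine top_le_iff.1 ?_
    calc ⊤ = g (g.symm ⊤) := (g.apply_symm_apply _).symm
      _ ≤ g ⊤ := hmono.monotone le_top
  obtain ⟨y, hy1, hy0⟩ := hg.exists_tendsto_fixedPoints h0 h1
  obtain ⟨z, hz0, hz1⟩ := hg.exists_tendsto_fixedPoints h1 h0
  have hz : ⊥ < z := by
    refine bot_lt_iff_ne_bot.2 fun h => ?_
    subst h
    have hfix : ∀ n : ℕ, (g ^ (-(n : ℤ))) ⊥ = ⊥ := fun n =>
      Equiv.Perm.zpow_apply_eq_self_of_apply_eq_self h0 _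
    simp only [hfix] at hz1
    exact bot_ne_top (tendsto_nhds_unique tendsto_const_nhds hz1)
  obtain ⟨n, hn⟩ := (hy0.eventually_lt_const hz).exists
  have hle : ∀ m : ℕ, (g ^ (m : ℤ)) y ≤ (g ^ ((m + n : ℕ) : ℤ)) z := fun m => by
    have := (hpow (m + n)).monotone hn.le
    rw [← zpow_natCast g, ← Equiv.Perm.mul_apply, ← zpow_add] at this
    simpa using this
  have := le_of_tendsto_of_tendsto' hy1 (hz0.comp (tendsto_add_atTop_nat n)) hle
  exact absurd this (by simp)

theorem TwoSidedLimitShadowing.exists_forward_shadow {Y : Type*} [MetricSpace Y]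
    {f : Equiv.Perm Y} (hf : TwoSidedLimitShadowing f) {x : ℕ → Y}
    (hx : Tendsto (fun n => dist (f (x n)) (x (n + 1))) atTop (𝓝 0)) :
    ∃ y, Tendsto (fun n : ℕ => dist ((f ^ n) y) (x n)) atTop (𝓝 0) := by
  obtain ⟨y, hy⟩ := hf (fun i => if 0 ≤ i then x i.toNat else (f ^ i) (x 0)) (by
    rw [IsTwoSidedLimitPseudoOrbit, Int.cofinite_eq, tendsto_sup]
    constructor
    · refine (tendsto_const_nhds (x := (0 : ℝ))).congr' ?_
      filter_upwards [eventually_lt_atBot 0] with i hi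
      have hfi : f ((f ^ i) (x 0)) = (f ^ (i + 1)) (x 0) := by
        rw [add_comm, zpow_add, zpow_one, Equiv.Perm.mul_apply]
      rw [if_neg hi.not_ge, hfi]
      rcases eq_or_ne i (-1) with rfl | h
      · simp
      · rw [if_neg (by omega), dist_self]
    · have htoNat : Tendsto Int.toNat atTop atTop := tendsto_atTop.2 fun n => by
        filter_upwards [eventually_ge_atTop (n : ℤ)] with i hi
        omega
      refine (hx.comp htoNat).congr' ?_
      filter_upwards [eventually_ge_atTop 0] with i hi
      have hi' : (i + 1).toNat = i.toNat + 1 := by omega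
      rw [if_pos hi, if_pos (by omega), hi']
      rfl)
  rw [Int.cofinite_eq, tendsto_sup] at hy
  refine ⟨y, (hy.2.comp tendsto_natCast_atTop_atTop).congr fun n => ?_⟩
  simp

theorem UnitAddCircle.exists_int_abs_sub_lt_of_dist_lt {x y r : ℝ}
    (h : dist (x : UnitAddCircle) y < r) : ∃ k : ℤ, |x - y - k| < r := by
  rw [dist_eq_norm, ← AddCircle.coe_sub, UnitAddCircle.norm_eq] at h
  exact ⟨_, h⟩

theorem UnitAddCircle.dist_coe_le (x y : ℝ) : dist (x : UnitAddCircle) y ≤ |x - y| := by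
  rw [dist_eq_norm, ← AddCircle.coe_sub, UnitAddCircle.norm_eq]
  simpa using round_le (x - y) 0

theorem UnitAddCircle.coe_eq_coe_iff {x y : ℝ} :
    (x : UnitAddCircle) = y ↔ ∃ k : ℤ, x = y + k := by
  rw [← sub_eq_zero, ← AddCircle.coe_sub, AddCircle.coe_eq_zero_iff]
  refine exists_congr fun k => ?_
  rw [zsmul_eq_mul, mul_one, eq_sub_iff_add_eq, add_comm]
  exact eq_comm

namespace CircleDeg1Lift

theorem abs_map_sub_map_sub_le (F : CircleDeg1Lift) (a b : ℝ) : |F a - F b - (a - b)| ≤ 1 := by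
  have key : ∀ a b, F a - F b ≤ a - b + 1 := fun a b => by
    have h1 : F a ≤ F (b + ⌈a - b⌉) := F.monotone (by linarith [Int.le_ceil (a - b)])
    rw [F.map_add_int] at h1
    linarith [Int.ceil_lt_add_one (a - b)]
  rw [abs_le]
  constructor <;> linarith [key a b, key b a]

theorem exists_forall_le_abs_pow_sub_pow {F G : CircleDeg1Lift}
    (h : F.translationNumber ≠ G.translationNumber) (C : ℝ) :
    ∃ n : ℕ, ∀ x, C ≤ |(F ^ n) x - (G ^ n) x| := by
  have hpos : 0 < |F.translationNumber - G.translationNumber| := abs_pos.2 (sub_ne_zero.2 h)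
  obtain ⟨n, hn⟩ := exists_nat_ge ((C + 4) / |F.translationNumber - G.translationNumber|)
  refine ⟨n, fun x => ?_⟩
  rw [div_le_iff₀ hpos, ← abs_of_nonneg (Nat.cast_nonneg (α := ℝ) n), ← abs_mul] at hn
  have key : ∀ H : CircleDeg1Lift, |(H ^ n) x - x - n * H.translationNumber| ≤ 2 := fun H => by
    have h1 := (H ^ n).abs_map_sub_map_sub_le x 0
    have h2 := H.dist_pow_map_zero_mul_translationNumber_le n
    rw [Real.dist_eq] at h2
    rw [abs_le] at *
    constructor <;> linarith
  have hF := abs_le.1 (key F)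
  have hG := abs_le.1 (key G)
  rcases le_abs.1 hn with hn | hn
  · exact le_abs.2 (Or.inl (by linarith))
  · exact le_abs.2 (Or.inr (by linarith))

theorem exists_pos_forall_abs_sub_lt {F : CircleDeg1Lift} (hF : Continuous F) {r : ℝ}
    (hr : 0 < r) : ∃ η > 0, ∀ a b, |a - b| < η → |F a - F b| < r := by
  obtain ⟨η, hη, h⟩ := Metric.uniformContinuousOn_iff.1
    (isCompact_Icc.uniformContinuousOn_of_continuous
      (hF.continuousOn (s := Set.Icc (-1 : ℝ) 2))) r hr
  refine ⟨min η 1, lt_min hη one_pos, fun a b hab => ?_⟩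
  have hab1 := abs_lt.1 (hab.trans_le (min_le_right _ _))
  have h0 := Int.floor_le a
  have h1 := Int.lt_floor_add_one a
  have := h (a - ⌊a⌋) ⟨by linarith, by linarith⟩ (b - ⌊a⌋) ⟨by linarith, by linarith⟩
    (by rw [Real.dist_eq, sub_sub_sub_cancel_right]; exact hab.trans_le (min_le_left _ _))
  rwa [F.map_sub_int, F.map_sub_int, Real.dist_eq, sub_sub_sub_cancel_right] at this

/-- The lift `x ↦ ε + F x`. -/
noncomputable def perturb (F : CircleDeg1Lift) (ε : ℝ) : CircleDeg1Lift :=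
  translate (Multiplicative.ofAdd ε) * F

@[simp]
theorem perturb_apply (F : CircleDeg1Lift) (ε x : ℝ) : F.perturb ε x = ε + F x := rfl

theorem add_pow_le_perturb_pow (F : CircleDeg1Lift) {ε : ℝ} (hε : 0 ≤ ε) {q : ℕ} (hq : 0 < q)
    (x : ℝ) : ε + (F ^ q) x ≤ (F.perturb ε ^ q) x := by
  obtain ⟨q, rfl⟩ := Nat.exists_eq_add_one.2 hq
  have h : F ≤ F.perturb ε := fun x => by simpa using hε
  have := F.monotone (pow_mono h q x)
  rw [pow_succ', pow_succ', mul_apply, mul_apply, perturb_apply]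
  linarith

theorem perturb_pow_le_add_pow (F : CircleDeg1Lift) {ε : ℝ} (hε : ε ≤ 0) {q : ℕ} (hq : 0 < q)
    (x : ℝ) : (F.perturb ε ^ q) x ≤ ε + (F ^ q) x := by
  obtain ⟨q, rfl⟩ := Nat.exists_eq_add_one.2 hq
  have h : F.perturb ε ≤ F := fun x => by simpa using hε
  have := F.monotone (pow_mono h q x)
  rw [pow_succ', pow_succ', mul_apply, mul_apply, perturb_apply]
  linarith

theorem coe_pow_apply_of_lift {F : CircleDeg1Lift} {g : Equiv.Perm UnitAddCircle}
    (h : ∀ x : ℝ, (F x : UnitAddCircle) = g x) (n : ℕ) (x : ℝ) :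
    ((F ^ n) x : UnitAddCircle) = (g ^ n) x := by
  induction n with
  | zero => simp
  | succ n ih => rw [pow_succ', pow_succ', mul_apply, Equiv.Perm.mul_apply, h, ih]

theorem exists_pow_near_add_int (F : CircleDeg1Lift) {ε : ℝ} (hε : 0 < ε) :
    ∃ q : ℕ, 0 < q ∧ ∃ (p : ℤ) (x : ℝ), |(F ^ q) x - x - p| < ε := by
  obtain ⟨l, φ, hφ, hl⟩ :=
    CompactSpace.tendsto_subseq (fun n : ℕ => (((F ^ n) 0 : ℝ) : UnitAddCircle))
  obtain ⟨k, hk⟩ := eventually_atTop.1 ((Metric.tendsto_nhds.1 hl) (ε / 2) (half_pos hε))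
  have hd : dist (((F ^ φ (k + 1)) 0 : ℝ) : UnitAddCircle) ((F ^ φ k) 0 : ℝ) < ε := by
    have h1 := hk k le_rfl
    have h2 := hk (k + 1) (Nat.le_succ k)
    simp only [Function.comp_apply] at h1 h2
    linarith [dist_triangle_right (((F ^ φ (k + 1)) 0 : ℝ) : UnitAddCircle)
      (((F ^ φ k) 0 : ℝ) : UnitAddCircle) l]
  obtain ⟨p, hp⟩ := UnitAddCircle.exists_int_abs_sub_lt_of_dist_lt hd
  have hlt : φ k < φ (k + 1) := hφ (Nat.lt_succ_self k)
  refine ⟨φ (k + 1) - φ k, Nat.sub_pos_of_lt hlt, p, (F ^ φ k) 0, ?_⟩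
  rwa [← mul_apply, ← pow_add, Nat.sub_add_cancel hlt.le]

/-- If small perturbations of `F` have the same translation number as `F`, then some power of `F`
moves points to both sides of a translation by an integer. -/
theorem exists_pow_lt_and_lt_pow {F : CircleDeg1Lift} {δ : ℝ} (hδ : 0 < δ)
    (h : ∀ ε, |ε| < δ → (F.perturb ε).translationNumber = F.translationNumber) :
    ∃ q : ℕ, 0 < q ∧ ∃ (p : ℤ) (a b : ℝ), (F ^ q) a < a + p ∧ b + p < (F ^ q) b := by
  set ε := δ / 2 with hεdef
  have hε : 0 < ε := half_pos hδ
  have hp := h ε (by rw [abs_of_pos hε]; exact half_lt_self hδ)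
  have hm := h (-ε) (by rw [abs_neg, abs_of_pos hε]; exact half_lt_self hδ)
  obtain ⟨q, hq, p, x, hx⟩ := F.exists_pow_near_add_int hε
  rw [abs_lt] at hx
  have hge : (p : ℝ) ≤ q * F.translationNumber := by
    rw [← hp, ← translationNumber_pow]
    refine le_translationNumber_of_add_int_le _ (x := x) ?_
    linarith [F.add_pow_le_perturb_pow hε.le hq x]
  have hle : q * F.translationNumber ≤ p := by
    rw [← hm, ← translationNumber_pow]
    refine translationNumber_le_of_le_add_int _ (x := x) ?_
    linarith [F.perturb_pow_le_add_pow (neg_nonpos.2 hε.le) hq x]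
  refine ⟨q, hq, p, ?_⟩
  have ha : ∃ a, (F ^ q) a < a + p := by
    by_contra! hcon
    have : (p : ℝ) + ε ≤ (F.perturb ε ^ q).translationNumber :=
      le_translationNumber_of_add_le _ fun y => by
        linarith [F.add_pow_le_perturb_pow hε.le hq y, hcon y]
    rw [translationNumber_pow, hp] at this
    linarith
  have hb : ∃ b, b + p < (F ^ q) b := by
    by_contra! hcon
    have : (F.perturb (-ε) ^ q).translationNumber ≤ (p : ℝ) - ε :=
      translationNumber_le_of_le_add _ fun y => by
        linarith [F.perturb_pow_le_add_pow (neg_nonpos.2 hε.le) hq y, hcon y]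
    rw [translationNumber_pow, hm] at this
    linarith
  obtain ⟨a, ha⟩ := ha
  obtain ⟨b, hb⟩ := hb
  exact ⟨a, b, ha, hb⟩

end CircleDeg1Lift

/-- A slowly growing sequence which takes the value `j` on a block of length `len j`. -/
theorem exists_tendsto_atTop_forall_block (len : ℕ → ℕ) :
    ∃ J : ℕ → ℕ, Tendsto J atTop atTop ∧
      ∀ j, ∃ N, j ≤ N ∧ ∀ n < len j, J (N + n) = j := by
  let N : ℕ → ℕ := fun j => ∑ i ∈ Finset.range j, (len i + 1)
  have hN : ∀ j, N (j + 1) = N j + (len j + 1) := fun j => Finset.sum_range_succ _ _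
  have hmono : StrictMono N := strictMono_nat_of_lt_succ fun j => by rw [hN]; omega
  have hle : ∀ j, j ≤ N j := fun _ => hmono.le_apply
  refine ⟨fun i => Nat.findGreatest (fun j => N j ≤ i) i, ?_, fun j => ⟨N j, hle j, ?_⟩⟩
  · refine tendsto_atTop.2 fun j => ?_
    filter_upwards [eventually_ge_atTop (N j)] with i hi
    exact Nat.le_findGreatest ((hle j).trans hi) hi
  · intro n hn
    refine Nat.findGreatest_eq_iff.2 ⟨(hle j).trans (Nat.le_add_right _ _),
      fun _ => Nat.le_add_right _ _, fun {k} hk _ hkN => ?_⟩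
    have := hmono.monotone (Nat.succ_le_of_lt hk)
    rw [Nat.succ_eq_add_one, hN] at this
    omega

theorem TwoSidedLimitShadowing.exists_translationNumber_perturb_eq
    {g : Equiv.Perm UnitAddCircle} (hg : TwoSidedLimitShadowing g) {F : CircleDeg1Lift}
    (hF : Continuous F) (hlift : ∀ x : ℝ, (F x : UnitAddCircle) = g x) :
    ∃ δ > 0, ∀ ε, |ε| < δ → (F.perturb ε).translationNumber = F.translationNumber := by
  by_contra! hcon
  choose e he hne using fun j : ℕ => hcon (1 / ((j : ℝ) + 1)) (by positivity)
  choose len hlen using fun j => CircleDeg1Lift.exists_forall_le_abs_pow_sub_pow (hne j) 4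
  obtain ⟨J, hJ, hblock⟩ := exists_tendsto_atTop_forall_block len
  have he0 : Tendsto (fun n => |e (J n)|) atTop (𝓝 0) :=
    (squeeze_zero (fun _ => abs_nonneg _) (fun j => (he j).le)
      tendsto_one_div_add_atTop_nhds_zero_nat).comp hJ
  obtain ⟨x, hx⟩ : ∃ x : ℕ → ℝ, ∀ n, x (n + 1) = e (J n) + F (x n) :=
    ⟨fun n => Nat.rec 0 (fun i xi => e (J i) + F xi) n, fun _ => rfl⟩
  have hpseudo : Tendsto (fun n : ℕ => dist (g (x n : UnitAddCircle)) (x (n + 1) : UnitAddCircle))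
      atTop (𝓝 0) := by
    refine squeeze_zero (fun _ => dist_nonneg) (fun n => ?_) he0
    rw [hx, ← hlift]
    refine (UnitAddCircle.dist_coe_le _ _).trans_eq ?_
    rw [sub_add_cancel_right, abs_neg]
  obtain ⟨y, hy⟩ := hg.exists_forward_shadow hpseudo
  obtain ⟨η', hη', hunif⟩ := CircleDeg1Lift.exists_pos_forall_abs_sub_lt hF (r := 1 / 4) (by norm_num)
  set η := min η' (1 / 4) with hηdef
  have hη : 0 < η := lt_min hη' (by norm_num)
  have hη4 : η ≤ 1 / 4 := min_le_right _ _
  obtain ⟨M, hM⟩ := eventually_atTop.1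
    ((hy.eventually_lt_const hη).and (he0.eventually_lt_const (show (0 : ℝ) < 1 / 4 by norm_num)))
  obtain ⟨N, hMN, hN⟩ := hblock M
  obtain ⟨w, hw⟩ : ∃ w : ℝ, (w : UnitAddCircle) = (g ^ N) y := QuotientAddGroup.mk_surjective _
  obtain ⟨m, hm⟩ := UnitAddCircle.exists_int_abs_sub_lt_of_dist_lt (hw ▸ (hM N hMN).1)
  obtain ⟨u, hu, hux⟩ : ∃ u : ℝ, (u : UnitAddCircle) = (g ^ N) y ∧ |u - x N| < η :=
    ⟨w - m, hw ▸ UnitAddCircle.coe_eq_coe_iff.2 ⟨-m, by push_cast; ring⟩, by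
      rwa [sub_right_comm]⟩
  have hclose : ∀ n : ℕ, |(F ^ n) u - x (N + n)| < η := fun n => by
    induction n with
    | zero => simpa using hux
    | succ n ih =>
      have h1 := hunif _ _ (ih.trans_le (min_le_left _ _))
      have h2 := (hM (N + n) (by omega)).2
      have h3 := (hM (N + (n + 1)) (by omega)).1
      rw [add_comm N (n + 1), pow_add, Equiv.Perm.mul_apply, ← hu,
        ← CircleDeg1Lift.coe_pow_apply_of_lift hlift, add_comm (n + 1) N] at h3
      obtain ⟨k, hk⟩ := UnitAddCircle.exists_int_abs_sub_lt_of_dist_lt h3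
      have hk0 : k = 0 := by
        rw [pow_succ', CircleDeg1Lift.mul_apply, ← add_assoc, hx] at hk
        rw [abs_lt] at h1 h2 hk
        have hk1 : (k : ℝ) < 1 := by linarith
        have hk2 : (-1 : ℝ) < k := by linarith
        have hk1' : k < 1 := by exact_mod_cast hk1
        have hk2' : -1 < k := by exact_mod_cast hk2
        omega
      simpa [hk0] using hk
  have hxN : ∀ n ≤ len M, x (N + n) = (F.perturb (e M) ^ n) (x N) := fun n => by
    induction n with
    | zero => intro _; simp
    | succ n ih =>
      intro hn
      rw [← add_assoc, hx, hN n hn, ih (Nat.le_of_succ_le hn), pow_succ',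
        CircleDeg1Lift.mul_apply, CircleDeg1Lift.perturb_apply]
  have h1 := hlen M (x N)
  have h2 := hclose (len M)
  have h3 := (F ^ len M).abs_map_sub_map_sub_le u (x N)
  rw [← hxN _ le_rfl] at h1
  rw [abs_lt] at h2 hux
  rw [abs_le] at h3
  rcases le_abs.1 h1 with h | h <;> linarith

theorem not_twoSidedLimitShadowing_of_lift_lt_of_lt_lift {g : Equiv.Perm UnitAddCircle}
    {F : CircleDeg1Lift} (hF : Continuous F) {p : ℤ}
    (hlift : ∀ x : ℝ, (F x : UnitAddCircle) = g x) {a b : ℝ} (ha : F a < a + p)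
    (hb : b + p < F b) : ¬ TwoSidedLimitShadowing g := by
  intro hg
  wlog hab : b ≤ a ∧ a < b + 1 generalizing b
  · refine this (b := b + ⌊a - b⌋) (by rw [F.map_add_int]; linarith) ⟨?_, ?_⟩
    · linarith [Int.floor_le (a - b)]
    · linarith [Int.lt_floor_add_one (a - b)]
  have hG : Continuous fun x => F x - p - x := by fun_prop
  have hfix : ∀ x, F x - p - x = 0 → g (x : UnitAddCircle) = x := fun x hx => by
    rw [← hlift]
    exact UnitAddCircle.coe_eq_coe_iff.2 ⟨p, by linarith⟩
  have hb1 : F (b + 1) = F b + 1 := F.map_add_one b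
  obtain ⟨P, hP, hP0⟩ : (0 : ℝ) ∈ (fun x => F x - p - x) '' Set.Ioo b a :=
    intermediate_value_Ioo' hab.1 hG.continuousOn ⟨by linarith, by linarith⟩
  obtain ⟨Q, hQ, hQ0⟩ : (0 : ℝ) ∈ (fun x => F x - p - x) '' Set.Ioo a (b + 1) :=
    intermediate_value_Ioo hab.2.le hG.continuousOn ⟨by linarith, by linarith⟩
  obtain ⟨y, hyQ, hyP⟩ := hg.exists_tendsto_fixedPoints (hfix P hP0) (hfix Q hQ0)
  obtain ⟨N, hN⟩ := ((Metric.tendsto_nhds.1 hyP) (min (P - b) (a - P))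
    (lt_min (sub_pos.2 hP.1) (sub_pos.2 hP.2))).exists
  obtain ⟨w, hw⟩ : ∃ w : ℝ, (w : UnitAddCircle) = (g ^ (-(N : ℤ))) y :=
    QuotientAddGroup.mk_surjective _
  obtain ⟨m, hm⟩ := UnitAddCircle.exists_int_abs_sub_lt_of_dist_lt (hw ▸ hN)
  have hm1 := abs_lt.1 (hm.trans_le (min_le_left _ _))
  have hm2 := abs_lt.1 (hm.trans_le (min_le_right _ _))
  have hstay : ∀ n : ℕ, ∃ v ∈ Set.Ioo b a, (v : UnitAddCircle) = (g ^ n) (w : UnitAddCircle) :=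
    fun n => by
      induction n with
      | zero =>
        exact ⟨w - m, ⟨by linarith, by linarith⟩,
          UnitAddCircle.coe_eq_coe_iff.2 ⟨-m, by push_cast; ring⟩⟩
      | succ n ih =>
        obtain ⟨v, hv, hvw⟩ := ih
        refine ⟨F v - p, ⟨by linarith [F.monotone hv.1.le], by linarith [F.monotone hv.2.le]⟩, ?_⟩
        rw [pow_succ', Equiv.Perm.mul_apply, ← hvw, ← hlift]
        exact UnitAddCircle.coe_eq_coe_iff.2 ⟨-p, by push_cast; ring⟩
  have hyQ' := (Metric.tendsto_nhds.1 hyQ) (min (Q - a) (b + 1 - Q))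
    (lt_min (sub_pos.2 hQ.1) (sub_pos.2 hQ.2))
  obtain ⟨n, hn⟩ := hyQ'.exists
  obtain ⟨v, hv, hvw⟩ := hstay (n + N)
  have hvy : (v : UnitAddCircle) = (g ^ (n : ℤ)) y := by
    rw [hvw, hw, ← zpow_natCast g, ← Equiv.Perm.mul_apply, ← zpow_add]
    congr 2
    push_cast
    ring
  rw [← hvy] at hn
  obtain ⟨k, hk⟩ := UnitAddCircle.exists_int_abs_sub_lt_of_dist_lt hn
  have hk1 := abs_lt.1 (hk.trans_le (min_le_left _ _))
  have hk2 := abs_lt.1 (hk.trans_le (min_le_right _ _))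
  rcases le_or_gt 0 k with h | h
  · have : (0 : ℝ) ≤ k := by exact_mod_cast h
    linarith [hv.2]
  · have : (k : ℝ) + 1 ≤ 0 := by exact_mod_cast h
    linarith [hv.1]

theorem UnitAddCircle.exists_continuous_lift (φ : C(UnitAddCircle, UnitAddCircle)) :
    ∃ F : C(ℝ, ℝ), ∀ x : ℝ, (F x : UnitAddCircle) = φ x := by
  obtain ⟨e, he⟩ : ∃ e : ℝ, (e : UnitAddCircle) = φ ((0 : ℝ) : UnitAddCircle) :=
    QuotientAddGroup.mk_surjective _
  obtain ⟨F, ⟨-, hF⟩, -⟩ := (AddCircle.isCoveringMap_coe (1 : ℝ)).existsUnique_continuousMap_lifts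
    (φ.comp ⟨fun x : ℝ => (x : UnitAddCircle), AddCircle.continuous_mk' 1⟩) 0 e he
  exact ⟨F, fun x => congrFun hF x⟩

/-- A continuous function whose values are all integers is constant. -/
theorem Continuous.exists_int_eq_of_forall_exists_int {f : ℝ → ℝ} (hf : Continuous f)
    (h : ∀ x, ∃ k : ℤ, f x = k) : ∃ k : ℤ, ∀ x, f x = k := by
  choose k hk using h
  have hk' : Continuous k := by
    rw [Int.isClosedEmbedding_coe_real.isInducing.continuous_iff]
    exact hf.congr hk
  exact ⟨k 0, fun x => by rw [hk, PreconnectedSpace.constant inferInstance hk' (y := 0)]⟩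

theorem Homeomorph.exists_circleDeg1Lift_sq (φ : UnitAddCircle ≃ₜ UnitAddCircle) :
    ∃ F : CircleDeg1Lift, Continuous F ∧ ∀ x : ℝ, (F x : UnitAddCircle) = φ (φ x) := by
  obtain ⟨F, hF⟩ := UnitAddCircle.exists_continuous_lift φ
  obtain ⟨H, hH⟩ := UnitAddCircle.exists_continuous_lift φ.symm
  have hdeg : ∀ (G : C(ℝ, ℝ)) (ψ : UnitAddCircle → UnitAddCircle)
      (_ : ∀ x : ℝ, (G x : UnitAddCircle) = ψ x),
      ∃ d : ℤ, ∀ (x : ℝ) (k : ℤ), G (x + k) = G x + k * d := by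
    intro G ψ hG
    obtain ⟨d, hd⟩ := Continuous.exists_int_eq_of_forall_exists_int
      (f := fun x => G (x + 1) - G x) (by fun_prop) fun x => by
        obtain ⟨k, hk⟩ := (UnitAddCircle.coe_eq_coe_iff (x := G (x + 1)) (y := G x)).1 (by
          rw [hG, hG, AddCircle.coe_add_period])
        exact ⟨k, by rw [hk, add_sub_cancel_left]⟩
    have hd' : ∀ x, G (x + 1) = G x + d := fun x => by linarith [hd x]
    refine ⟨d, fun x k => ?_⟩
    induction k with
    | zero => simp
    | succ i ih =>
      push_cast at ih ⊢
      rw [← add_assoc, hd', ih]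
      ring
    | pred i ih =>
      have := hd' (x + (-(i : ℝ) - 1))
      push_cast at ih ⊢
      rw [show x + (-(i : ℝ) - 1) + 1 = x + -i by ring, ih] at this
      linarith
  obtain ⟨d, hd⟩ := hdeg F φ hF
  obtain ⟨d', hd'⟩ := hdeg H φ.symm hH
  obtain ⟨c, hc⟩ := Continuous.exists_int_eq_of_forall_exists_int
    (f := fun x => H (F x) - x) (by fun_prop) fun x => by
      obtain ⟨k, hk⟩ := (UnitAddCircle.coe_eq_coe_iff (x := H (F x)) (y := x)).1 (by
        rw [hH, hF]; exact φ.symm_apply_apply _)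
      exact ⟨k, by rw [hk, add_sub_cancel_left]⟩
  have hdd : d * d' = 1 := by
    have h0 := hc 0
    have h1 := hc (0 + 1)
    have h2 := hd 0 1
    have h3 := hd' (F 0) d
    rw [Int.cast_one, one_mul] at h2
    rw [h2, h3] at h1
    have : (d : ℝ) * d' = 1 := by linarith
    exact_mod_cast this
  have hsq : d * d = 1 := by
    rcases Int.eq_one_or_neg_one_of_mul_eq_one hdd with h | h <;> simp [h]
  have hinj : Function.Injective F := fun x z hxz => by
    have h0 := hc x
    have h1 := hc z
    simp only [hxz] at h0
    linarith
  have hmono : StrictMono fun x => F (F x) := by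
    rcases F.continuous.strictMono_of_inj hinj with h | h
    · exact h.comp h
    · exact h.comp h
  refine ⟨⟨⟨fun x => F (F x), hmono.monotone⟩, fun x => ?_⟩, by
    change Continuous fun x => F (F x); fun_prop, fun x => ?_⟩
  · have h1 := hd x 1
    have h2 := hd (F x) d
    have h3 : (d : ℝ) * d = 1 := by exact_mod_cast hsq
    change F (F (x + 1)) = F (F x) + 1
    rw [Int.cast_one, one_mul] at h1
    rw [h1, h2, h3]
  · change ((F (F x) : ℝ) : UnitAddCircle) = _
    rw [hF, hF]
    rfl

theorem not_twoSidedLimitShadowing_unitAddCircle (φ : UnitAddCircle ≃ₜ UnitAddCircle) :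
    ¬ TwoSidedLimitShadowing φ.toEquiv := by
  intro hφ
  have hg := TwoSidedLimitShadowing.pow (f := φ.toEquiv) hφ two_pos
  obtain ⟨F, hF, hlift⟩ := φ.exists_circleDeg1Lift_sq
  obtain ⟨δ, hδ, h⟩ := hg.exists_translationNumber_perturb_eq hF hlift
  obtain ⟨q, hq, p, a, b, ha, hb⟩ := CircleDeg1Lift.exists_pow_lt_and_lt_pow hδ h
  exact not_twoSidedLimitShadowing_of_lift_lt_of_lt_lift (F.continuous_pow hF q)
    (CircleDeg1Lift.coe_pow_apply_of_lift hlift q) ha hb (hg.pow hq)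

/-- No homeomorphism of the closed unit interval has the two-sided limit shadowing
property, and no homeomorphism of the unit circle has the two-sided limit shadowing
property. -/
theorem stmt9 :
    (∀ f : (Set.Icc (0 : ℝ) 1) ≃ₜ (Set.Icc (0 : ℝ) 1),
      ¬ TwoSidedLimitShadowing f.toEquiv) ∧
    (∀ f : Circle ≃ₜ Circle, ¬ TwoSidedLimitShadowing f.toEquiv) := by
  refine ⟨not_twoSidedLimitShadowing_unitInterval, fun f hf => ?_⟩
  let h : UnitAddCircle ≃ₜ Circle := AddCircle.homeomorphCircle one_ne_zero
  exact not_twoSidedLimitShadowing_unitAddCircle ((h.trans f).trans h.symm)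
    (TwoSidedLimitShadowing.symm_conj hf h)
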